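/- With Ĥ(α, g) as defined below (K ≥ 1, N̂ ≥ 1, τ > 0, λ_i ≥ 0, data points y_n^i ∈ ℝ^d and support points ȳ_p ∈ ℝ^d), the minimax exchange holds: min_{α ∈ Δ_{N̂}} sup_{g ∈ ℝ^{K×N̂}} Ĥ(α, g) = sup_{g ∈ ℝ^{K×N̂}} min_{α ∈ Δ_{N̂}} Ĥ(α, g). -/

import Mathlib

open Real Finset

/-- Sion's minimax theorem for a real-valued function on a compact convex set times a whole space. -/
theorem Sion.ciInf_ciSup_eq_ciSup_ciInf {E F : Type*}
    [TopologicalSpace E] [AddCommGroup E] [Module ℝ E] [IsTopologicalAddGroup E]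
    [ContinuousSMul ℝ E] [TopologicalSpace F] [AddCommGroup F] [Module ℝ F]
    [IsTopologicalAddGroup F] [ContinuousSMul ℝ F] {X : Set E} {f : E → F → ℝ}
    (ne_X : X.Nonempty) (cX : Convex ℝ X) (kX : IsCompact X)
    (hfy : ∀ y, LowerSemicontinuousOn (fun x ↦ f x y) X)
    (hfy' : ∀ y, QuasiconvexOn ℝ X fun x ↦ f x y)
    (hfx : ∀ x ∈ X, UpperSemicontinuous (f x))
    (hfx' : ∀ x ∈ X, QuasiconcaveOn ℝ Set.univ (f x))
    (hbdd : ∀ x ∈ X, BddAbove (Set.range (f x))) :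
    ⨅ x : X, ⨆ y, f x y = ⨆ y, ⨅ x : X, f x y := by
  have : Nonempty X := ne_X.to_subtype
  have hbelow (y : F) : BddBelow (Set.range fun x : X ↦ f x y) := by
    have h := (hfy y).bddBelow_of_isCompact kX
    rwa [Set.image_eq_range] at h
  have hSup : BddBelow (Set.range fun x : X ↦ ⨆ y, f x y) := by
    obtain ⟨b, hb⟩ := hbelow 0
    refine ⟨b, ?_⟩
    rintro _ ⟨x, rfl⟩
    exact (hb ⟨x, rfl⟩).trans (le_ciSup (hbdd x x.2) 0)
  have hInf : BddAbove (Set.range fun y ↦ ⨅ x : X, f x y) := by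
    obtain ⟨x, hx⟩ := ne_X
    obtain ⟨b, hb⟩ := hbdd x hx
    refine ⟨b, ?_⟩
    rintro _ ⟨y, rfl⟩
    exact (ciInf_le (hbelow y) ⟨x, hx⟩).trans (hb ⟨y, rfl⟩)
  refine Sion.minimax (Y := Set.univ) ne_X kX (fun y _ ↦ hfy y) (fun y _ ↦ hfy' y) convex_univ
    (fun x hx ↦ (hfx x hx).upperSemicontinuousOn _) hfx' cX
    (fun x ↦ ⨆ y, f x y) (fun x hx ↦ ?_) _ ?_ (fun y ↦ ⨅ x : X, f x y) (fun y _ ↦ ?_) _ ?_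
  · convert isLUB_ciSup (hbdd x hx) using 1
    simp [Set.range]
  · convert isGLB_ciInf hSup using 1
    ext; simp
  · convert isGLB_ciInf (hbelow y) using 1
    ext; simp
  · convert isLUB_ciSup hInf using 1
    simp [Set.range]

/-- The infimum of finitely many functions `g ↦ c p - g p` is concave. -/
theorem concaveOn_ciInf_sub {ι : Type*} [Finite ι] [Nonempty ι] (c : ι → ℝ) :
    ConcaveOn ℝ Set.univ fun g : ι → ℝ ↦ ⨅ p, (c p - g p) := by
  refine ⟨convex_univ, fun x _ y _ a b ha hb hab ↦ le_ciInf fun p ↦ ?_⟩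
  have hx : ⨅ q, (c q - x q) ≤ c p - x p := ciInf_le (Set.finite_range _).bddBelow p
  have hy : ⨅ q, (c q - y q) ≤ c p - y p := ciInf_le (Set.finite_range _).bddBelow p
  calc a • (⨅ q, (c q - x q)) + b • (⨅ q, (c q - y q))
      ≤ a * (c p - x p) + b * (c p - y p) := by
        simp only [smul_eq_mul]; gcongr
    _ = (a + b) * c p - (a * x p + b * y p) := by ring
    _ = c p - (a • x + b • y) p := by simp [hab]

theorem continuous_ciInf_sub {ι : Type*} [Fintype ι] [Nonempty ι] (c : ι → ℝ) :
    Continuous fun g : ι → ℝ ↦ ⨅ p, (c p - g p) := by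
  simp_rw [← Finset.inf'_univ_eq_ciInf]
  exact Continuous.finset_inf'_apply _ fun p _ ↦ by fun_prop

/-- An infimum over a finite type is at most any weighted average. -/
theorem ciInf_le_sum_mul_of_mem_stdSimplex {ι : Type*} [Fintype ι] {α : ι → ℝ}
    (hα : α ∈ stdSimplex ℝ ι) (c : ι → ℝ) : ⨅ p, c p ≤ ∑ p, α p * c p :=
  calc ⨅ p, c p = ∑ p, α p * ⨅ q, c q := by rw [← Finset.sum_mul, hα.2, one_mul]
    _ ≤ ∑ p, α p * c p := Finset.sum_le_sum fun p _ ↦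
        mul_le_mul_of_nonneg_left (ciInf_le (Set.finite_range c).bddBelow p) (hα.1 p)

theorem ConcaveOn.finset_sum {ι E : Type*} [AddCommGroup E] [Module ℝ E] {s : Set E}
    (hs : Convex ℝ s) (t : Finset ι) {f : ι → E → ℝ} (hf : ∀ i ∈ t, ConcaveOn ℝ s (f i)) :
    ConcaveOn ℝ s fun x ↦ ∑ i ∈ t, f i x := by
  refine ⟨hs, fun x hx y hy a b ha hb hab ↦ ?_⟩
  simp only [Finset.smul_sum, ← Finset.sum_add_distrib]
  exact Finset.sum_le_sum fun i hi ↦ (hf i hi).2 hx hy ha hb hab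

/-- The negative entropy is convex on the simplex. -/
theorem convexOn_stdSimplex_sum_mul_log {ι : Type*} [Fintype ι] :
    ConvexOn ℝ (stdSimplex ℝ ι) fun α ↦ ∑ n, α n * Real.log (α n) := by
  refine ⟨convex_stdSimplex ℝ ι, fun x hx y hy a b ha hb hab ↦ ?_⟩
  simp only [Finset.smul_sum, ← Finset.sum_add_distrib]
  exact Finset.sum_le_sum fun n _ ↦ Real.convexOn_mul_log.2 (hx.1 n) (hy.1 n) ha hb hab

/-- Minimax exchange (Sion) for the Lagrangian-form objective of the empirical
penalized Wasserstein barycenter problem: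
`min_{α ∈ Δ} sup_g Ĥ(α, g) = sup_g min_{α ∈ Δ} Ĥ(α, g)`. -/
theorem lagrangian_minimax_exchange
    (d K Nhat : ℕ) (hd : 1 ≤ d) (hK : 1 ≤ K) (hNhat : 1 ≤ Nhat)
    (τ : ℝ) (hτ : 0 < τ)
    (N : Fin K → ℕ) (hN : ∀ i, 1 ≤ N i)
    (lam : Fin K → ℝ) (hlam : ∀ i, 0 ≤ lam i)
    (y : (i : Fin K) → Fin (N i) → EuclideanSpace ℝ (Fin d))
    (ybar : Fin Nhat → EuclideanSpace ℝ (Fin d)) :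
    let H : (Fin Nhat → ℝ) → (Fin K → Fin Nhat → ℝ) → ℝ := fun α g =>
      (∑ i, lam i * ((1 / (N i : ℝ)) *
          ∑ n, ⨅ p, (‖y i n - ybar p‖ ^ 2 - g i p)))
        + (∑ n, (∑ i, lam i * g i n) * α n)
        + τ * ∑ n, α n * Real.log (α n)
    (⨅ α : stdSimplex ℝ (Fin Nhat), ⨆ g : Fin K → Fin Nhat → ℝ, H α g)
      = ⨆ g : Fin K → Fin Nhat → ℝ, ⨅ α : stdSimplex ℝ (Fin Nhat), H α g := by
  intro H
  have : Nonempty (Fin Nhat) := ⟨⟨0, hNhat⟩⟩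
  refine Sion.ciInf_ciSup_eq_ciSup_ciInf (f := H)
    ⟨_, single_mem_stdSimplex ℝ (Classical.arbitrary (Fin Nhat))⟩
    (convex_stdSimplex ℝ _) (isCompact_stdSimplex ℝ _) (fun g ↦ ?_) (fun g ↦ ?_) (fun α hα ↦ ?_)
    (fun α hα ↦ ?_) (fun α hα ↦ ?_)
  · refine Continuous.lowerSemicontinuous ?_ |>.lowerSemicontinuousOn _
    have hlog (n : Fin Nhat) : Continuous fun α : Fin Nhat → ℝ ↦ α n * Real.log (α n) :=
      Real.continuous_mul_log.comp (continuous_apply n)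
    fun_prop
  · refine ConvexOn.quasiconvexOn ?_
    refine ConvexOn.add ⟨convex_stdSimplex ℝ _, fun x hx z hz a b ha hb hab ↦ le_of_eq ?_⟩
      (convexOn_stdSimplex_sum_mul_log.smul hτ.le)
    simp only [Pi.add_apply, Pi.smul_apply, smul_eq_mul, mul_add, Finset.sum_add_distrib,
      Finset.mul_sum _ _ a, Finset.mul_sum _ _ b, mul_left_comm _ a, mul_left_comm _ b]
    simp only [← Finset.mul_sum]
    rw [add_add_add_comm, ← add_mul, hab, one_mul]
  · refine Continuous.upperSemicontinuous ?_
    have hmin (i : Fin K) (n : Fin (N i)) : Continuous fun g : Fin K → Fin Nhat → ℝ ↦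
        ⨅ p, (‖y i n - ybar p‖ ^ 2 - g i p) :=
      (continuous_ciInf_sub fun p ↦ ‖y i n - ybar p‖ ^ 2).comp (continuous_apply i)
    fun_prop
  · refine ConcaveOn.quasiconcaveOn ?_
    refine ConcaveOn.add_const (ConcaveOn.add ?_ ⟨convex_univ,
      fun x hx z hz a b ha hb hab ↦ le_of_eq ?_⟩) _
    · refine ConcaveOn.finset_sum convex_univ _ fun i _ ↦ ConcaveOn.smul (hlam i) <|
        ConcaveOn.smul (by positivity) <| ConcaveOn.finset_sum convex_univ _ fun n _ ↦ ?_
      exact (concaveOn_ciInf_sub fun p ↦ ‖y i n - ybar p‖ ^ 2).comp_linearMap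
        (LinearMap.proj (φ := fun _ : Fin K ↦ Fin Nhat → ℝ) i)
    · simp only [Pi.add_apply, Pi.smul_apply, smul_eq_mul, Finset.sum_mul, Finset.mul_sum,
        ← Finset.sum_add_distrib]
      exact Finset.sum_congr rfl fun _ _ ↦ Finset.sum_congr rfl fun _ _ ↦ by ring
  · refine ⟨(∑ i, lam i * ((1 / (N i : ℝ)) * ∑ n, ∑ p, α p * ‖y i n - ybar p‖ ^ 2))
      + τ * ∑ n, α n * Real.log (α n), ?_⟩
    rintro _ ⟨g, rfl⟩
    refine add_le_add_left ?_ _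
    have hswap : ∑ n, (∑ i, lam i * g i n) * α n = ∑ i, lam i * ∑ n, α n * g i n := by
      simp only [Finset.sum_mul, Finset.mul_sum]
      rw [Finset.sum_comm]
      exact Finset.sum_congr rfl fun _ _ ↦ Finset.sum_congr rfl fun _ _ ↦ by ring
    rw [hswap, ← Finset.sum_add_distrib]
    refine Finset.sum_le_sum fun i _ ↦ ?_
    rw [← mul_add]
    refine mul_le_mul_of_nonneg_left ?_ (hlam i)
    have hNi : (N i : ℝ) ≠ 0 := by
      have := hN i
      positivity
    calc _ ≤ (1 / (N i : ℝ)) * ∑ n, ∑ p, α p * (‖y i n - ybar p‖ ^ 2 - g i p)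
          + ∑ p, α p * g i p := by
          gcongr
          exact ciInf_le_sum_mul_of_mem_stdSimplex hα _
      _ = _ := by
          simp only [mul_sub, Finset.sum_sub_distrib, Finset.sum_const, Finset.card_univ,
            Fintype.card_fin, nsmul_eq_mul]
          field_simp
          ring
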